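/- Let G be a connected affine algebraic group over an algebraically closed field k, F : G → G an isogeny, and x₀ ∈ G(k). The twisted Lang map L_{x₀} : G → G, g ↦ g·x₀·F(g)⁻¹, is surjective if and only if the twisted stabilizer G^{x₀,F} = {g ∈ G : g·x₀·F(g)⁻¹ = x₀} is finite. -/

import Mathlib

open MvPolynomial Matrix

noncomputable section

/-- Coordinates for `GL n` viewed as a closed subvariety of affine `2n²`-space
via `g ↦ (g, g⁻¹)`. -/
abbrev Coord (n : ℕ) := (Fin n × Fin n) ⊕ (Fin n × Fin n)

def coords {k : Type} [Field k] {n : ℕ} (g : GL (Fin n) k) : Coord n → k :=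
  Sum.elim (fun p => (g : Matrix (Fin n) (Fin n) k) p.1 p.2)
    (fun p => ((g⁻¹ : GL (Fin n) k) : Matrix (Fin n) (Fin n) k) p.1 p.2)

/-- Zariski-closed subsets of `GL n`. -/
def IsZClosed {k : Type} [Field k] {n : ℕ} (S : Set (GL (Fin n) k)) : Prop :=
  ∃ I : Set (MvPolynomial (Coord n) k),
    S = {g | ∀ P ∈ I, MvPolynomial.eval (coords g) P = 0}

/-- Connectedness in the Zariski topology. -/
def IsZConnected {k : Type} [Field k] {n : ℕ} (G : Set (GL (Fin n) k)) : Prop :=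
  ∀ S T : Set (GL (Fin n) k), IsZClosed S → IsZClosed T → G ⊆ S ∪ T →
    G ∩ (S ∩ T) = ∅ → G ∩ S = ∅ ∨ G ∩ T = ∅

/-- A map `GL n → GL m` is regular on `G` if its coordinates are polynomial
functions of the coordinates of the source. -/
def IsRegularMapOn {k : Type} [Field k] {n m : ℕ} (G : Set (GL (Fin n) k))
    (F : GL (Fin n) k → GL (Fin m) k) : Prop :=
  ∃ P : Coord m → MvPolynomial (Coord n) k,
    ∀ g ∈ G, coords (F g) = fun i => MvPolynomial.eval (coords g) (P i)

/-- `F` is an isogeny from the algebraic group `G` onto the algebraic group `H`: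
a regular surjective homomorphism of algebraic groups with finite kernel. -/
structure IsIsogeny {k : Type} [Field k] {n m : ℕ} (G : Subgroup (GL (Fin n) k))
    (H : Subgroup (GL (Fin m) k)) (F : GL (Fin n) k → GL (Fin m) k) : Prop where
  maps : ∀ g ∈ G, F g ∈ H
  hom : ∀ g ∈ G, ∀ h ∈ G, F (g * h) = F g * F h
  regular : IsRegularMapOn (G : Set (GL (Fin n) k)) F
  surj : ∀ h ∈ H, ∃ g ∈ G, F g = h
  finKer : {g : GL (Fin n) k | g ∈ G ∧ F g = 1}.Finite

/-- The fibres of a twisted Lang map through a finite stable subgroup are controlled by the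
twisted stabilizer: if most translates of every point lie in the image, then the image contains
the whole subgroup. -/
theorem mem_range_twistedLang_of_finite_subgroup {X : Type*} [Group X] (F : X →* X) (x₀ : X)
    (hS : {s : X | s * x₀ * (F s)⁻¹ = x₀}.Finite) {d r N : ℕ}
    (hN : {s : X | s * x₀ * (F s)⁻¹ = x₀}.ncard ≤ N) (hr : d * N < r)
    (c : Fin r → X)
    (hU : ∀ x : X, ∀ J : Finset (Fin r), d < J.card →
      ∃ j ∈ J, ∃ g : X, g * x₀ * (F g)⁻¹ = x * (c j)⁻¹)
    (Γ : Subgroup X) [Finite Γ] (hF : ∀ g ∈ Γ, F g ∈ Γ) (hc : ∀ j, c j ∈ Γ)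
    {x : X} (hx : x ∈ Γ) : ∃ g : X, g * x₀ * (F g)⁻¹ = x := by
  classical
  set L : X → X := fun g => g * x₀ * (F g)⁻¹ with hL
  set S : Set X := {s : X | s * x₀ * (F s)⁻¹ = x₀} with hSdef
  have hLmul : ∀ g h, L (g * h) = g * L h * (F g)⁻¹ := by
    intro g h; simp only [hL, _root_.map_mul, _root_.mul_inv_rev]; group
  set V : Set Γ := {y | ∃ g, L g = y} with hV
  let E : SubMulAction Γ X :=
    { carrier := {g | L g ∈ Γ}
      smul_mem' := by
        intro h g hg
        change L ((h : X) * g) ∈ Γ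
        rw [hLmul]
        exact Γ.mul_mem (Γ.mul_mem h.2 hg) (Γ.inv_mem (hF _ h.2)) }
  have e1 : Nonempty (E ≃ V × S) := by
    choose σ hσ using fun v : V => v.2
    have key : ∀ g h, L g = L h → g⁻¹ * h ∈ S := by
      intro g h e
      change L (g⁻¹ * h) = x₀
      rw [hLmul, ← e, ← hLmul, inv_mul_cancel]
      simp [hL]
    have key2 : ∀ g, ∀ s ∈ S, L (g * s) = L g := by
      intro g s hs
      rw [hLmul, show L s = x₀ from hs]
    refine ⟨⟨fun g => ⟨⟨⟨L g, g.2⟩, g, rfl⟩, ⟨(σ ⟨⟨L g, g.2⟩, g, rfl⟩)⁻¹ * g,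
        key _ _ (hσ ⟨⟨L g, g.2⟩, g, rfl⟩)⟩⟩,
      fun p => ⟨σ p.1 * p.2, ?_⟩, ?_, ?_⟩⟩
    · change L _ ∈ Γ
      rw [key2 _ _ p.2.2, hσ]
      exact p.1.1.2
    · intro g; ext; simp
    · rintro ⟨v, s⟩
      have h1 : L (σ v * s) = v := by rw [key2 _ _ s.2, hσ]
      have h2 : ∀ (h : L (σ v * s) ∈ Γ), (⟨⟨L (σ v * s), h⟩, _, rfl⟩ : V) = v := by
        intro h; ext; exact h1
      ext
      · simp [h1]
      · simp [h2]
  obtain ⟨e1⟩ := e1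
  have hcardE : Nat.card E = Nat.card V * S.ncard := by
    rw [Nat.card_congr e1, Nat.card_prod]; rfl
  have e2 : E ≃ Quotient (MulAction.orbitRel Γ E) × Γ := by
    refine MulAction.selfEquivOrbitsQuotientProd ?_
    intro b
    rw [eq_bot_iff]
    intro h hh
    have h1 : ((h : X) * (b : X)) = b := congrArg Subtype.val (MulAction.mem_stabilizer_iff.1 hh)
    rw [Subgroup.mem_bot]
    ext
    simpa using h1
  have hdvd : Nat.card Γ ∣ Nat.card E := by
    rw [Nat.card_congr e2, Nat.card_prod]
    exact dvd_mul_left _ _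
  have : Fintype Γ := Fintype.ofFinite _
  set W : Finset Γ := Finset.univ.filter (· ∉ V) with hW
  have hVW : Nat.card V + W.card = Nat.card Γ := by
    have h1 : Nat.card V = (Finset.univ.filter (· ∈ V)).card := by
      rw [Nat.card_eq_fintype_card, Fintype.card_subtype]
    rw [h1, hW, Finset.card_filter_add_card_filter_not, Nat.card_eq_fintype_card]
    rfl
  have hdc : r * W.card ≤ d * Nat.card Γ := by
    have h1 := Finset.sum_card_bipartiteAbove_eq_sum_card_bipartiteBelow
      (s := (Finset.univ : Finset (Fin r))) (t := (Finset.univ : Finset Γ))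
      (fun j y => y * (⟨c j, hc j⟩ : Γ)⁻¹ ∉ V)
    have h2 : ∀ j : Fin r, (Finset.bipartiteAbove
        (fun (j : Fin r) (y : Γ) => y * (⟨c j, hc j⟩ : Γ)⁻¹ ∉ V) Finset.univ j).card =
          W.card := by
      intro j
      refine Finset.card_bij (fun y _ => y * (⟨c j, hc j⟩ : Γ)⁻¹) ?_ ?_ ?_
      · intro y hy; simpa [Finset.bipartiteAbove, hW] using hy
      · intro y _ z _ e; simpa using e
      · intro y hy
        refine ⟨y * ⟨c j, hc j⟩, ?_, by simp⟩
        simpa [Finset.bipartiteAbove, hW] using hy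
    have h3 : ∀ y : Γ, (Finset.bipartiteBelow
        (fun (j : Fin r) (y : Γ) => y * (⟨c j, hc j⟩ : Γ)⁻¹ ∉ V) Finset.univ y).card ≤ d := by
      intro y
      by_contra! hlt
      obtain ⟨j, hj, g, hg⟩ := hU y _ hlt
      simp only [Finset.bipartiteBelow, Finset.mem_filter, Finset.mem_univ, true_and] at hj
      exact hj ⟨g, by simpa [hL] using hg⟩
    simp only [h2, Finset.sum_const, Finset.card_univ, Fintype.card_fin, smul_eq_mul] at h1
    rw [h1]
    refine (Finset.sum_le_sum fun y _ => h3 y).trans ?_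
    simp [mul_comm]
  have hSpos : 0 < S.ncard := by
    rw [Set.ncard_pos hS]
    exact ⟨1, by simp [hSdef]⟩
  have hΓpos : 0 < Nat.card Γ := Nat.card_pos
  obtain ⟨q, hq⟩ := hdvd
  have hW0 : W.card = 0 := by
    have h1 : Nat.card Γ * q + W.card * S.ncard = Nat.card Γ * S.ncard := by
      rw [← hq, hcardE, ← hVW]; ring
    have h2 : W.card * S.ncard < Nat.card Γ := by
      have : r * (W.card * S.ncard) < r * Nat.card Γ := by
        calc r * (W.card * S.ncard) = (r * W.card) * S.ncard := by ring
          _ ≤ (d * Nat.card Γ) * N := Nat.mul_le_mul hdc hN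
          _ = (d * N) * Nat.card Γ := by ring
          _ < r * Nat.card Γ := Nat.mul_lt_mul_of_pos_right hr hΓpos
      exact Nat.lt_of_mul_lt_mul_left this
    have h3 : q = S.ncard := by
      rcases lt_trichotomy q S.ncard with h | h | h
      · have : Nat.card Γ * (q + 1) ≤ Nat.card Γ * S.ncard := Nat.mul_le_mul_left _ h
        nlinarith
      · exact h
      · have : Nat.card Γ * (S.ncard + 1) ≤ Nat.card Γ * q := Nat.mul_le_mul_left _ h
        nlinarith
    rw [h3] at h1
    have : W.card * S.ncard = 0 := by omega
    rcases Nat.mul_eq_zero.1 this with h | h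
    · exact h
    · omega
  rw [Finset.card_eq_zero] at hW0
  by_contra hne
  have : (⟨x, hx⟩ : Γ) ∈ W := by
    simp only [hW, Finset.mem_filter, Finset.mem_univ, true_and]
    exact hne
  simp [hW0] at this

open FirstOrder Language Ring in
/-- A property of tuples of field elements that is defined by one formula over all fields. -/
def IsElementary {β : Type} (P : ∀ (K : Type) [Field K], (β → K) → Prop) : Prop :=
  ∃ φ : Language.ring.Formula β, ∀ (K : Type) [Field K] [CompatibleRing K] (v : β → K),
    φ.Realize v ↔ P K v

/-- A function of tuples of field elements given by one integral polynomial over all fields. -/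
def IsIntegralPoly {β : Type} (f : ∀ (K : Type) [Field K], (β → K) → K) : Prop :=
  ∃ p : FreeCommRing β, ∀ (K : Type) [Field K] (v : β → K), f K v = FreeCommRing.lift v p

namespace IsIntegralPoly

variable {β γ : Type} {f g : ∀ (K : Type) [Field K], (β → K) → K}

theorem var (i : β) : IsIntegralPoly (fun _ _ v => v i) :=
  ⟨FreeCommRing.of i, fun K _ v => by simp⟩

theorem one : IsIntegralPoly (β := β) (fun _ _ _ => 1) :=
  ⟨1, fun K _ v => by simp⟩

theorem zero : IsIntegralPoly (β := β) (fun _ _ _ => 0) :=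
  ⟨0, fun K _ v => by simp⟩

theorem mul (hf : IsIntegralPoly f) (hg : IsIntegralPoly g) :
    IsIntegralPoly (fun K _ v => f K v * g K v) := by
  obtain ⟨p, hp⟩ := hf
  obtain ⟨q, hq⟩ := hg
  exact ⟨p * q, fun K _ v => by simp [hp, hq]⟩

theorem sum {ι : Type} {s : Finset ι} {f : ι → ∀ (K : Type) [Field K], (β → K) → K}
    (hf : ∀ i, IsIntegralPoly (f i)) : IsIntegralPoly (fun K _ v => ∑ i ∈ s, f i K v) := by
  choose p hp using hf
  exact ⟨∑ i ∈ s, p i, fun K _ v => by simp [hp]⟩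

theorem lift {w : ∀ (K : Type) [Field K], (β → K) → γ → K}
    (hw : ∀ i, IsIntegralPoly (fun K _ v => w K v i)) (p : FreeCommRing γ) :
    IsIntegralPoly (fun K _ v => FreeCommRing.lift (w K v) p) := by
  choose q hq using hw
  refine ⟨FreeCommRing.lift q p, fun K _ v => ?_⟩
  have : (FreeCommRing.lift (w K v)) = (FreeCommRing.lift v).comp (FreeCommRing.lift q) := by
    refine FreeCommRing.hom_ext fun i => ?_
    simp [hq]
  exact DFunLike.congr_fun this p

end IsIntegralPoly

namespace IsElementary

open FirstOrder Language Ring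

variable {β γ : Type} {P Q : ∀ (K : Type) [Field K], (β → K) → Prop}

theorem eq {f g : ∀ (K : Type) [Field K], (β → K) → K} (hf : IsIntegralPoly f)
    (hg : IsIntegralPoly g) : IsElementary (fun K _ v => f K v = g K v) := by
  obtain ⟨p, hp⟩ := hf
  obtain ⟨q, hq⟩ := hg
  refine ⟨(termOfFreeCommRing p).equal (termOfFreeCommRing q), fun K _ _ v => ?_⟩
  simp [hp, hq, Formula.realize_equal]

theorem congr (h : ∀ (K : Type) [Field K] (v : β → K), P K v ↔ Q K v) (hP : IsElementary P) :
    IsElementary Q := by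
  obtain ⟨φ, hφ⟩ := hP
  exact ⟨φ, fun K _ _ v => (hφ K v).trans (h K v)⟩

theorem imp (hP : IsElementary P) (hQ : IsElementary Q) :
    IsElementary (fun K _ v => P K v → Q K v) := by
  obtain ⟨φ, hφ⟩ := hP
  obtain ⟨ψ, hψ⟩ := hQ
  exact ⟨φ.imp ψ, fun K _ _ v => by simp [hφ, hψ, Formula.realize_imp]⟩

theorem and (hP : IsElementary P) (hQ : IsElementary Q) :
    IsElementary (fun K _ v => P K v ∧ Q K v) := by
  obtain ⟨φ, hφ⟩ := hP
  obtain ⟨ψ, hψ⟩ := hQ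
  exact ⟨φ ⊓ ψ, fun K _ _ v => by simp [hφ, hψ, Formula.realize_inf]⟩

theorem const (p : Prop) : IsElementary (β := β) (fun _ _ _ => p) := by
  by_cases hp : p
  · exact ⟨⊤, fun K _ _ v => by simp [hp]⟩
  · exact ⟨⊥, fun K _ _ v => by simp [hp]⟩

theorem forall_finite {ι : Type} [Finite ι] {P : ι → ∀ (K : Type) [Field K], (β → K) → Prop}
    (hP : ∀ i, IsElementary (P i)) : IsElementary (fun K _ v => ∀ i, P i K v) := by
  choose φ hφ using hP
  exact ⟨Formula.iInf φ, fun K _ _ v => by simp [hφ]⟩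

theorem exists_finite {ι : Type} [Finite ι] {P : ι → ∀ (K : Type) [Field K], (β → K) → Prop}
    (hP : ∀ i, IsElementary (P i)) : IsElementary (fun K _ v => ∃ i, P i K v) := by
  choose φ hφ using hP
  exact ⟨Formula.iSup φ, fun K _ _ v => by simp [hφ]⟩

theorem forall_tuple [Finite γ] {P : ∀ (K : Type) [Field K], (β → K) → (γ → K) → Prop}
    (hP : IsElementary (β := β ⊕ γ) fun K _ v =>
      P K (fun i => v (.inl i)) (fun i => v (.inr i))) :
    IsElementary (fun K _ v => ∀ w : γ → K, P K v w) := by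
  obtain ⟨φ, hφ⟩ := hP
  exact ⟨φ.iAlls γ, fun K _ _ v => by simp [hφ, Formula.realize_iAlls]⟩

theorem exists_tuple [Finite γ] {P : ∀ (K : Type) [Field K], (β → K) → (γ → K) → Prop}
    (hP : IsElementary (β := β ⊕ γ) fun K _ v =>
      P K (fun i => v (.inl i)) (fun i => v (.inr i))) :
    IsElementary (fun K _ v => ∃ w : γ → K, P K v w) := by
  obtain ⟨φ, hφ⟩ := hP
  exact ⟨φ.iExs γ, fun K _ _ v => by simp [hφ, Formula.realize_iExs]⟩

theorem tuple_eq [Finite γ] {f g : ∀ (K : Type) [Field K], (β → K) → γ → K}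
    (hf : ∀ i, IsIntegralPoly fun K _ v => f K v i)
    (hg : ∀ i, IsIntegralPoly fun K _ v => g K v i) :
    IsElementary (fun K _ v => f K v = g K v) := by
  simp only [funext_iff]
  exact forall_finite fun i => eq (hf i) (hg i)

/-- An elementary sentence that holds over the algebraic closures of all prime fields of
positive characteristic holds over every algebraically closed field. -/
theorem of_forall_prime {P : ∀ (K : Type) [Field K], Prop}
    (hP : IsElementary (β := Empty) (fun K _ _ => P K))
    (h : ∀ (p : ℕ) [Fact p.Prime], P (AlgebraicClosure (ZMod p)))
    (K : Type) [Field K] [IsAlgClosed K] : P K := by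
  obtain ⟨φ, hφ⟩ := hP
  have key : ∀ p : ℕ, p.Prime → Theory.ACF p ⊨ᵇ (φ : Language.ring.Sentence) := by
    intro p hp
    have : Fact p.Prime := ⟨hp⟩
    let := compatibleRingOfRing (AlgebraicClosure (ZMod p))
    rw [← (Field.ACF_isComplete (Or.inl hp)).realize_sentence_iff _ (AlgebraicClosure (ZMod p))]
    exact (hφ _ _).2 (h p)
  have key0 : ∀ p : ℕ, (p.Prime ∨ p = 0) → Theory.ACF p ⊨ᵇ (φ : Language.ring.Sentence) := by
    rintro p (hp | rfl)
    · exact key p hp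
    · rw [Field.ACF_zero_realize_iff_infinite_ACF_prime_realize]
      convert! Set.infinite_univ (α := Nat.Primes)
      rw [Set.eq_univ_iff_forall]
      intro ⟨p, hp⟩
      exact key p hp
  let p := ringChar K
  let := compatibleRingOfRing K
  have h1 := key0 p (CharP.char_is_prime_or_zero K p)
  rw [← (Field.ACF_isComplete (CharP.char_is_prime_or_zero K p)).realize_sentence_iff _ K] at h1
  exact (hφ _ _).1 h1

end IsElementary

/-- The multiplication of `GL n` in coordinates. -/
def coordMul {K : Type} [Field K] {n : ℕ} (w z : Coord n → K) : Coord n → K :=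
  Sum.elim (fun p => ∑ l, w (.inl (p.1, l)) * z (.inl (l, p.2)))
    (fun p => ∑ l, z (.inr (p.1, l)) * w (.inr (l, p.2)))

/-- The inversion of `GL n` in coordinates. -/
def coordInv {K : Type} [Field K] {n : ℕ} (w : Coord n → K) : Coord n → K :=
  fun i => w i.swap

/-- The unit of `GL n` in coordinates. -/
def coordOne (K : Type) [Field K] (n : ℕ) : Coord n → K :=
  Sum.elim (fun p => if p.1 = p.2 then 1 else 0) (fun p => if p.1 = p.2 then 1 else 0)

section Coordinates

variable {K : Type} [Field K] {n : ℕ}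

theorem coords_mul (g h : GL (Fin n) K) : coords (g * h) = coordMul (coords g) (coords h) := by
  ext (i | i) <;> simp only [coords, coordMul, Sum.elim_inl, Sum.elim_inr, _root_.mul_inv_rev,
    Units.val_mul, Matrix.mul_apply]

theorem coords_inv (g : GL (Fin n) K) : coords g⁻¹ = coordInv (coords g) := by
  ext (i | i) <;> simp [coords, coordInv]

theorem coords_one : coords (1 : GL (Fin n) K) = coordOne K n := by
  ext (i | i) <;> simp [coords, coordOne, Matrix.one_apply]

theorem coords_injective : Function.Injective (coords : GL (Fin n) K → Coord n → K) := by
  intro g h e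
  ext i j
  exact congrFun e (.inl (i, j))

theorem exists_coords_eq {w : Coord n → K} (hw : coordMul w (coordInv w) = coordOne K n) :
    ∃ g : GL (Fin n) K, coords g = w := by
  let A : Matrix (Fin n) (Fin n) K := Matrix.of fun i j => w (.inl (i, j))
  let B : Matrix (Fin n) (Fin n) K := Matrix.of fun i j => w (.inr (i, j))
  have hAB : A * B = 1 := by
    ext i j
    have := congrFun hw (.inl (i, j))
    simpa [coordMul, coordInv, coordOne, A, B, Matrix.mul_apply, Matrix.one_apply] using this
  refine ⟨⟨A, B, hAB, mul_eq_one_comm.1 hAB⟩, ?_⟩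
  ext (i | i) <;> rfl

theorem coordMul_coordInv_coords (g : GL (Fin n) K) :
    coordMul (coords g) (coordInv (coords g)) = coordOne K n := by
  rw [← coords_inv, ← coords_mul, mul_inv_cancel, coords_one]

theorem coordMul_mem {A : Type} [SetLike A K] [SubringClass A K] {s : A} {w z : Coord n → K}
    (hw : ∀ i, w i ∈ s) (hz : ∀ i, z i ∈ s) (i) : coordMul w z i ∈ s := by
  rcases i with i | i
  · exact sum_mem (t := Finset.univ) fun l _ => mul_mem (hw (.inl (i.1, l))) (hz (.inl (l, i.2)))
  · exact sum_mem (t := Finset.univ) fun l _ => mul_mem (hz (.inr (i.1, l))) (hw (.inr (l, i.2)))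

theorem coordOne_mem {A : Type} [SetLike A K] [SubringClass A K] (s : A) (i) :
    coordOne K n i ∈ s := by
  rcases i with i | i <;> simp only [coordOne, Sum.elim_inl, Sum.elim_inr] <;> split_ifs <;>
    simp [zero_mem, one_mem]

end Coordinates

section Family

variable {n : ℕ} {α ι : Type} (P : ι → FreeCommRing (α ⊕ Coord n))
  (Q : Coord n → FreeCommRing (α ⊕ Coord n))

/-- Points of `GL n` on which the integral polynomials `P` with parameters `a` vanish. -/
def IsFamilyPoint {K : Type} [Field K] (a : α → K) (w : Coord n → K) : Prop :=
  coordMul w (coordInv w) = coordOne K n ∧ ∀ i, FreeCommRing.lift (Sum.elim a w) (P i) = 0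

/-- The polynomial map of coordinate space with integral coefficients and parameters `a`. -/
def familyMap {K : Type} [Field K] (a : α → K) (w : Coord n → K) : Coord n → K :=
  fun i => FreeCommRing.lift (Sum.elim a w) (Q i)

/-- Hypotheses under which the twisted Lang map of an endomorphism of a linear algebraic group
is surjective: its fibres have at most `N` points, and for every point `x` at most `d` of the
`r` translates of `x` lie outside of its image. -/
structure IsTwistedLangFamily (d r N : ℕ) {K : Type} [Field K] (a : α → K) (x₀ : Coord n → K)
    (c : Fin r × Coord n → K) : Prop where
  one : IsFamilyPoint P a (coordOne K n)
  mul : ∀ w z, IsFamilyPoint P a w → IsFamilyPoint P a z → IsFamilyPoint P a (coordMul w z)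
  inv : ∀ w, IsFamilyPoint P a w → IsFamilyPoint P a (coordInv w)
  maps : ∀ w, IsFamilyPoint P a w → IsFamilyPoint P a (familyMap Q a w)
  map_mul : ∀ w z, IsFamilyPoint P a w → IsFamilyPoint P a z →
    familyMap Q a (coordMul w z) = coordMul (familyMap Q a w) (familyMap Q a z)
  base : IsFamilyPoint P a x₀
  translates : ∀ j, IsFamilyPoint P a fun i => c (j, i)
  fibre : ∀ s : Fin (N + 1) × Coord n → K,
    (∀ m, IsFamilyPoint P a (fun i => s (m, i)) ∧
      coordMul (fun i => s (m, i)) x₀ = coordMul x₀ (familyMap Q a fun i => s (m, i))) →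
    ∃ m m', m ≠ m' ∧ (fun i => s (m, i)) = fun i => s (m', i)
  cover : ∀ x, IsFamilyPoint P a x → ∀ J : Finset (Fin r), d < J.card → ∃ j, j ∈ J ∧
    ∃ g, IsFamilyPoint P a g ∧ coordMul g x₀ =
      coordMul (coordMul x (coordInv fun i => c (j, i))) (familyMap Q a g)

variable {P Q} in
theorem isTwistedLangFamily_iff {d r N : ℕ} {K : Type} [Field K] (a : α → K) (x₀ : Coord n → K)
    (c : Fin r × Coord n → K) : IsTwistedLangFamily P Q d r N a x₀ c ↔
    IsFamilyPoint P a (coordOne K n) ∧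
    (∀ w z, IsFamilyPoint P a w → IsFamilyPoint P a z → IsFamilyPoint P a (coordMul w z)) ∧
    (∀ w, IsFamilyPoint P a w → IsFamilyPoint P a (coordInv w)) ∧
    (∀ w, IsFamilyPoint P a w → IsFamilyPoint P a (familyMap Q a w)) ∧
    (∀ w z, IsFamilyPoint P a w → IsFamilyPoint P a z →
      familyMap Q a (coordMul w z) = coordMul (familyMap Q a w) (familyMap Q a z)) ∧
    IsFamilyPoint P a x₀ ∧
    (∀ j, IsFamilyPoint P a fun i => c (j, i)) ∧
    (∀ s : Fin (N + 1) × Coord n → K,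
      (∀ m, IsFamilyPoint P a (fun i => s (m, i)) ∧
        coordMul (fun i => s (m, i)) x₀ = coordMul x₀ (familyMap Q a fun i => s (m, i))) →
      ∃ m m', m ≠ m' ∧ (fun i => s (m, i)) = fun i => s (m', i)) ∧
    (∀ x, IsFamilyPoint P a x → ∀ J : Finset (Fin r), d < J.card → ∃ j, j ∈ J ∧
      ∃ g, IsFamilyPoint P a g ∧ coordMul g x₀ =
        coordMul (coordMul x (coordInv fun i => c (j, i))) (familyMap Q a g)) :=
  ⟨fun ⟨h₁, h₂, h₃, h₄, h₅, h₆, h₇, h₈, h₉⟩ => ⟨h₁, h₂, h₃, h₄, h₅, h₆, h₇, h₈, h₉⟩,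
    fun ⟨h₁, h₂, h₃, h₄, h₅, h₆, h₇, h₈, h₉⟩ => ⟨h₁, h₂, h₃, h₄, h₅, h₆, h₇, h₈, h₉⟩⟩

/-- The twisted Lang map of a family is surjective. -/
def TwistedLangSurjective (d r N : ℕ) (K : Type) [Field K] : Prop :=
  ∀ (a : α → K) (x₀ : Coord n → K) (c : Fin r × Coord n → K),
    IsTwistedLangFamily P Q d r N a x₀ c →
    ∀ x, IsFamilyPoint P a x → ∃ g, IsFamilyPoint P a g ∧
      coordMul g x₀ = coordMul x (familyMap Q a g)

variable {P Q}

theorem IsTwistedLangFamily.exists_eq_of_isAlgebraic [Finite α] {d r N : ℕ} (hr : d * N < r)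
    {κ K : Type} [Field κ] [Finite κ] [Field K] [Algebra κ K] [Algebra.IsAlgebraic κ K]
    {a : α → K} {x₀ : Coord n → K} {c : Fin r × Coord n → K}
    (h : IsTwistedLangFamily P Q d r N a x₀ c) (x : Coord n → K) (hx : IsFamilyPoint P a x) :
    ∃ g, IsFamilyPoint P a g ∧ coordMul g x₀ = coordMul x (familyMap Q a g) := by
  classical
  let X : Subgroup (GL (Fin n) K) :=
    { carrier := {g | IsFamilyPoint P a (coords g)}
      one_mem' := by simpa [coords_one] using h.one
      mul_mem' := fun {g g'} hg hg' => by
        simpa [coords_mul] using h.mul _ _ hg hg'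
      inv_mem' := fun {g} hg => by simpa [coords_inv] using h.inv _ hg }
  have hlift : ∀ w, IsFamilyPoint P a w → ∃ g : X, coords (g : GL (Fin n) K) = w := by
    intro w hw
    obtain ⟨g, rfl⟩ := exists_coords_eq hw.1
    exact ⟨⟨g, hw⟩, rfl⟩
  choose f hf using fun g : X => hlift _ (h.maps _ g.2)
  let F : X →* X := MonoidHom.mk' f fun g g' => by
    apply Subtype.ext
    apply coords_injective
    rw [hf, Subgroup.coe_mul, coords_mul, h.map_mul _ _ g.2 g'.2, Subgroup.coe_mul, coords_mul,
      hf, hf]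
  obtain ⟨y₀, hy₀⟩ := hlift _ h.base
  choose b hb using fun j => hlift _ (h.translates j)
  obtain ⟨y, rfl⟩ := hlift _ hx
  have hiff : ∀ g z : X, g * y₀ * (F g)⁻¹ = z ↔ coordMul (coords (g : GL (Fin n) K))
      x₀ = coordMul (coords (z : GL (Fin n) K)) (familyMap Q a (coords (g : GL (Fin n) K))) := by
    intro g z
    rw [← hf, ← hy₀, ← coords_mul, ← coords_mul, coords_injective.eq_iff, mul_inv_eq_iff_eq_mul,
      Subtype.ext_iff]
    rfl
  set S : Set X := {s | s * y₀ * (F s)⁻¹ = y₀} with hSdef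
  have hS : ¬ ∃ e : Fin (N + 1) → X, Function.Injective e ∧ ∀ i, e i ∈ S := by
    rintro ⟨e, he, heS⟩
    obtain ⟨m, m', hne, hmm⟩ := h.fibre (fun p => coords (e p.1 : GL (Fin n) K) p.2)
      fun m => ⟨(e m).2, by simpa [hy₀] using (hiff _ _).1 (heS m)⟩
    exact hne (he (Subtype.ext (coords_injective hmm)))
  have hSfin : S.Finite := by
    by_contra hinf
    have : Infinite S := Set.infinite_coe_iff.2 hinf
    exact hS ⟨fun i => (Infinite.natEmbedding S) i,
      fun i j e => Fin.ext ((Infinite.natEmbedding S).injective (Subtype.ext e)),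
      fun i => (Infinite.natEmbedding S i).2⟩
  have hScard : S.ncard ≤ N := by
    by_contra! hlt
    have : Finite S := hSfin
    have hlt' : N + 1 ≤ Nat.card S := hlt
    let e := (Finite.equivFin S).symm
    exact hS ⟨fun i => e (Fin.castLE hlt' i),
      fun i j h => Fin.castLE_injective hlt' (e.injective (Subtype.ext h)), fun i => (e _).2⟩
  let T : Set K := Set.range a ∪ Set.range (coords (y : GL (Fin n) K)) ∪
    ⋃ j, Set.range (coords (b j : GL (Fin n) K))
  have hT : T.Finite := by
    refine (Set.Finite.union (Set.finite_range _) (Set.finite_range _)).union ?_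
    exact Set.finite_iUnion fun j => Set.finite_range _
  let R : Subalgebra κ K := Algebra.adjoin κ T
  have hR : Finite R := by
    have : Module.Finite κ R := ⟨(Submodule.fg_top _).2
      (fg_adjoin_of_finite hT fun x _ => Algebra.IsIntegral.isIntegral x)⟩
    exact Module.finite_of_finite κ
  have haR : ∀ t, a t ∈ R := fun t => Algebra.subset_adjoin (Or.inl (Or.inl ⟨t, rfl⟩))
  let Γ : Subgroup X :=
    { carrier := {g | ∀ i, coords (g : GL (Fin n) K) i ∈ R}
      one_mem' := fun i => by
        rw [Subgroup.coe_one, coords_one]; exact coordOne_mem R i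
      mul_mem' := fun {g g'} hg hg' i => by
        rw [Subgroup.coe_mul, coords_mul]; exact coordMul_mem hg hg' i
      inv_mem' := fun {g} hg i => by
        rw [Subgroup.coe_inv, coords_inv]; exact hg _ }
  have hΓ : Finite Γ := by
    refine Finite.of_injective
      (fun (g : Γ) (i : Coord n) => (⟨coords ((g : X) : GL (Fin n) K) i, g.2 i⟩ : R)) ?_
    intro g g' e
    apply Subtype.ext
    apply Subtype.ext
    apply coords_injective
    ext i
    exact congrArg Subtype.val (congrFun e i)
  obtain ⟨g, hg⟩ := mem_range_twistedLang_of_finite_subgroup F y₀ hSfin hScard hr b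
    (fun z J hJ => by
      obtain ⟨j, hj, w, hw, e⟩ := h.cover _ z.2 J hJ
      obtain ⟨g, rfl⟩ := hlift _ hw
      refine ⟨j, hj, g, (hiff _ _).2 ?_⟩
      rw [e, Subgroup.coe_mul, Subgroup.coe_inv, coords_mul, coords_inv, hb]) Γ
    (fun g hg i => by
      change coords (f g : GL (Fin n) K) i ∈ R
      rw [hf]
      have : ∀ q : FreeCommRing (α ⊕ Coord n),
          FreeCommRing.lift (Sum.elim a (coords (g : GL (Fin n) K))) q ∈ R := by
        intro q
        induction q using FreeCommRing.induction_on with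
        | neg_one => simp [one_mem]
        | of t =>
          rcases t with t | t
          · simpa using haR t
          · simpa using hg t
        | add p q hp hq => rw [_root_.map_add]; exact add_mem hp hq
        | mul p q hp hq => rw [_root_.map_mul]; exact mul_mem hp hq
      exact this _)
    (fun j i => Algebra.subset_adjoin (Or.inr (Set.mem_iUnion.2 ⟨j, i, rfl⟩)))
    (x := y) (fun i => Algebra.subset_adjoin (Or.inl (Or.inr ⟨i, rfl⟩)))
  exact ⟨_, g.2, (hiff _ _).1 hg⟩

section Elementary

open IsElementary

variable {β : Type}

theorem isIntegralPoly_coordMul {w z : ∀ (K : Type) [Field K], (β → K) → Coord n → K}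
    (hw : ∀ i, IsIntegralPoly fun K _ v => w K v i)
    (hz : ∀ i, IsIntegralPoly fun K _ v => z K v i) (i : Coord n) :
    IsIntegralPoly fun K _ v => coordMul (w K v) (z K v) i := by
  rcases i with i | i
  · exact .sum (s := Finset.univ)
      (f := fun l K _ v => w K v (.inl (i.1, l)) * z K v (.inl (l, i.2)))
      fun l => .mul (hw _) (hz _)
  · exact .sum (s := Finset.univ)
      (f := fun l K _ v => z K v (.inr (i.1, l)) * w K v (.inr (l, i.2)))
      fun l => .mul (hz _) (hw _)

theorem isIntegralPoly_coordInv {w : ∀ (K : Type) [Field K], (β → K) → Coord n → K}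
    (hw : ∀ i, IsIntegralPoly fun K _ v => w K v i) (i : Coord n) :
    IsIntegralPoly fun K _ v => coordInv (w K v) i :=
  hw _

theorem isIntegralPoly_coordOne (i : Coord n) :
    IsIntegralPoly (β := β) fun K _ _ => coordOne K n i := by
  rcases i with i | i <;> simp only [coordOne, Sum.elim_inl, Sum.elim_inr] <;> split_ifs
  exacts [.one, .zero, .one, .zero]

theorem isIntegralPoly_lift_elim {a : ∀ (K : Type) [Field K], (β → K) → α → K}
    {w : ∀ (K : Type) [Field K], (β → K) → Coord n → K}
    (ha : ∀ i, IsIntegralPoly fun K _ v => a K v i)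
    (hw : ∀ i, IsIntegralPoly fun K _ v => w K v i) (p : FreeCommRing (α ⊕ Coord n)) :
    IsIntegralPoly fun K _ v => FreeCommRing.lift (Sum.elim (a K v) (w K v)) p :=
  .lift (w := fun K _ v => Sum.elim (a K v) (w K v)) (by rintro (i | i) <;> simp [ha, hw]) p

theorem isElementary_isFamilyPoint [Finite ι] {a : ∀ (K : Type) [Field K], (β → K) → α → K}
    {w : ∀ (K : Type) [Field K], (β → K) → Coord n → K}
    (ha : ∀ i, IsIntegralPoly fun K _ v => a K v i)
    (hw : ∀ i, IsIntegralPoly fun K _ v => w K v i) :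
    IsElementary fun K _ v => IsFamilyPoint P (a K v) (w K v) :=
  .and (tuple_eq (isIntegralPoly_coordMul hw (isIntegralPoly_coordInv hw))
    isIntegralPoly_coordOne)
    (forall_finite fun i => .eq (isIntegralPoly_lift_elim ha hw (P i)) .zero)

theorem isIntegralPoly_familyMap {a : ∀ (K : Type) [Field K], (β → K) → α → K}
    {w : ∀ (K : Type) [Field K], (β → K) → Coord n → K}
    (ha : ∀ i, IsIntegralPoly fun K _ v => a K v i)
    (hw : ∀ i, IsIntegralPoly fun K _ v => w K v i) (i : Coord n) :
    IsIntegralPoly fun K _ v => familyMap Q (a K v) (w K v) i :=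
  isIntegralPoly_lift_elim ha hw (Q i)

theorem isElementary_isTwistedLangFamily [Finite ι] {d r N : ℕ} (a : α → β) (x₀ : Coord n → β)
    (c : Fin r × Coord n → β) : IsElementary fun K _ v => IsTwistedLangFamily P Q d r N (K := K)
      (fun i => v (a i)) (fun i => v (x₀ i)) (fun i => v (c i)) := by
  refine .congr (fun K _ v => (isTwistedLangFamily_iff (fun i => v (a i)) (fun i => v (x₀ i))
    (fun i => v (c i))).symm) ?_
  refine .and (isElementary_isFamilyPoint ?_ isIntegralPoly_coordOne) <|
    .and (forall_tuple <| forall_tuple <| .imp (isElementary_isFamilyPoint ?_ ?_) <|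
      .imp (isElementary_isFamilyPoint ?_ ?_) <|
      isElementary_isFamilyPoint ?_ <| isIntegralPoly_coordMul ?_ ?_) <|
    .and (forall_tuple <| .imp (isElementary_isFamilyPoint ?_ ?_) <|
      isElementary_isFamilyPoint ?_ <| isIntegralPoly_coordInv ?_) <|
    .and (forall_tuple <| .imp (isElementary_isFamilyPoint ?_ ?_) <|
      isElementary_isFamilyPoint ?_ <| isIntegralPoly_familyMap ?_ ?_) <|
    .and (forall_tuple <| forall_tuple <| .imp (isElementary_isFamilyPoint ?_ ?_) <|
      .imp (isElementary_isFamilyPoint ?_ ?_) <|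
      tuple_eq (isIntegralPoly_familyMap ?_ <| isIntegralPoly_coordMul ?_ ?_) <|
        isIntegralPoly_coordMul (isIntegralPoly_familyMap ?_ ?_)
          (isIntegralPoly_familyMap ?_ ?_)) <|
    .and (isElementary_isFamilyPoint ?_ ?_) <|
    .and (forall_finite fun j => isElementary_isFamilyPoint ?_ ?_) <|
    .and (forall_tuple <| .imp (forall_finite fun m => .and (isElementary_isFamilyPoint ?_ ?_) <|
      tuple_eq (isIntegralPoly_coordMul ?_ ?_)
        (isIntegralPoly_coordMul ?_ (isIntegralPoly_familyMap ?_ ?_))) <|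
      exists_finite fun m => exists_finite fun m' => .and (.const _) (tuple_eq ?_ ?_)) <|
    forall_tuple <| .imp (isElementary_isFamilyPoint ?_ ?_) <| forall_finite fun J =>
      .imp (.const _) <| exists_finite fun j => .and (.const _) <| exists_tuple <|
      .and (isElementary_isFamilyPoint ?_ ?_) <| tuple_eq (isIntegralPoly_coordMul ?_ ?_) <|
      isIntegralPoly_coordMul (isIntegralPoly_coordMul ?_ (isIntegralPoly_coordInv ?_))
        (isIntegralPoly_familyMap ?_ ?_)
  all_goals exact fun i => .var _

theorem isElementary_twistedLangSurjective [Finite α] [Finite ι] (d r N : ℕ) :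
    IsElementary (β := Empty) fun K _ _ => TwistedLangSurjective P Q d r N K := by
  refine forall_tuple (forall_tuple (forall_tuple (.imp
    (isElementary_isTwistedLangFamily _ _ _) (forall_tuple (.imp (isElementary_isFamilyPoint ?_ ?_)
    (exists_tuple (.and (isElementary_isFamilyPoint ?_ ?_) (tuple_eq
    (isIntegralPoly_coordMul ?_ ?_) (isIntegralPoly_coordMul ?_
    (isIntegralPoly_familyMap ?_ ?_))))))))))
  all_goals exact fun i => .var _

end Elementary

theorem twistedLangSurjective_of_isAlgClosed [Finite α] [Finite ι] {d r N : ℕ} (hr : d * N < r)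
    (K : Type) [Field K] [IsAlgClosed K] : TwistedLangSurjective P Q d r N K :=
  (isElementary_twistedLangSurjective d r N).of_forall_prime
    (fun p _ _ _ _ h => h.exists_eq_of_isAlgebraic hr (κ := ZMod p)) K

end Family

/-- A Zariski closed set is cut out by finitely many equations. -/
theorem IsZClosed.exists_finset {k : Type} [Field k] {n : ℕ} {S : Set (GL (Fin n) k)}
    (hS : IsZClosed S) : ∃ s : Finset (MvPolynomial (Coord n) k),
      ∀ g, g ∈ S ↔ ∀ P ∈ s, MvPolynomial.eval (coords g) P = 0 := by
  obtain ⟨I, rfl⟩ := hS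
  obtain ⟨s, hs⟩ := (isNoetherianRing_iff_ideal_fg _).1 inferInstance (Ideal.span I)
  refine ⟨s, fun g => ?_⟩
  have key : ∀ T : Set (MvPolynomial (Coord n) k),
      (∀ P ∈ T, MvPolynomial.eval (coords g) P = 0) ↔
      Ideal.span T ≤ RingHom.ker (MvPolynomial.eval (coords g)) := by
    intro T
    rw [Ideal.span_le]
    rfl
  have h1 := key I
  rw [← hs, ← key] at h1
  exact h1

/-- If the fibres of the twisted Lang map are finite and sufficiently many of the translates of
every point by finitely many given elements lie in its image, then it is surjective. -/
theorem twistedLang_surjective_of_cover {k : Type} [Field k] [IsAlgClosed k] {n : ℕ}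
    (G : Subgroup (GL (Fin n) k)) (hGcl : IsZClosed (G : Set (GL (Fin n) k)))
    (F : GL (Fin n) k → GL (Fin n) k) (hmaps : ∀ g ∈ G, F g ∈ G)
    (hhom : ∀ g ∈ G, ∀ h ∈ G, F (g * h) = F g * F h)
    (hreg : IsRegularMapOn (G : Set (GL (Fin n) k)) F)
    {x₀ : GL (Fin n) k} (hx₀ : x₀ ∈ G)
    (hS : {g : GL (Fin n) k | g ∈ G ∧ g * x₀ * (F g)⁻¹ = x₀}.Finite)
    {d r N : ℕ} (hN : {g : GL (Fin n) k | g ∈ G ∧ g * x₀ * (F g)⁻¹ = x₀}.ncard ≤ N)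
    (hr : d * N < r) (c : Fin r → GL (Fin n) k) (hc : ∀ j, c j ∈ G)
    (hcover : ∀ x ∈ G, ∀ J : Finset (Fin r), d < J.card →
      ∃ j ∈ J, ∃ g ∈ G, g * x₀ * (F g)⁻¹ = x * (c j)⁻¹) :
    ∀ x ∈ G, ∃ g ∈ G, g * x₀ * (F g)⁻¹ = x := by
  classical
  obtain ⟨s, hs⟩ := hGcl.exists_finset
  obtain ⟨Q, hQ⟩ := hreg
  let p : s ⊕ Coord n → MvPolynomial (Coord n) k := Sum.elim Subtype.val Q
  let mons : s ⊕ Coord n → Finset (Coord n →₀ ℕ) := fun i => (p i).support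
  let a : (Σ i, mons i) → k := fun i => (p i.1).coeff i.2.1
  let P' : s → FreeCommRing ((Σ i, mons i) ⊕ Coord n) :=
    fun i => FirstOrder.Ring.genericPolyMap mons (.inl i)
  let Q' : Coord n → FreeCommRing ((Σ i, mons i) ⊕ Coord n) :=
    fun i => FirstOrder.Ring.genericPolyMap mons (.inr i)
  have hlift : ∀ i w, FreeCommRing.lift (Sum.elim a w) (FirstOrder.Ring.genericPolyMap mons i) =
      MvPolynomial.eval w (p i) := by
    intro i w
    rw [FirstOrder.Ring.lift_genericPolyMap]
    have := FirstOrder.Ring.MvPolynomialSupportLEEquiv_symm_apply_coeff p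
    simp only [Sum.elim_comp_inr, Sum.elim_comp_inl]
    exact congrArg (fun q => MvPolynomial.eval w (q.1 i)) this
  have hpt : ∀ g, IsFamilyPoint P' a (coords g) ↔ g ∈ G := by
    intro g
    rw [IsFamilyPoint, ← SetLike.mem_coe, hs]
    simp only [coordMul_coordInv_coords, true_and, P', hlift, p, Sum.elim_inl, Subtype.forall]
  have hpt' : ∀ w, IsFamilyPoint P' a w → ∃ g ∈ G, coords g = w := by
    intro w hw
    obtain ⟨g, rfl⟩ := exists_coords_eq hw.1
    exact ⟨g, (hpt g).1 hw, rfl⟩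
  have hmap : ∀ g ∈ G, familyMap Q' a (coords g) = coords (F g) := by
    intro g hg
    rw [hQ g hg]
    ext i
    simp only [familyMap, Q', hlift, p, Sum.elim_inr]
  have heq : ∀ g ∈ G, ∀ z, g * x₀ * (F g)⁻¹ = z ↔ coordMul (coords g) (coords x₀) =
      coordMul (coords z) (familyMap Q' a (coords g)) := by
    intro g hg z
    rw [hmap g hg, ← coords_mul, ← coords_mul, coords_injective.eq_iff, mul_inv_eq_iff_eq_mul]
  have hfam : IsTwistedLangFamily P' Q' d r N a (coords x₀) (fun i => coords (c i.1) i.2) := by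
    refine ⟨?_, ?_, ?_, ?_, ?_, ?_, ?_, ?_, ?_⟩
    · rw [← coords_one, hpt]; exact G.one_mem
    · intro w z hw hz
      obtain ⟨g, hg, rfl⟩ := hpt' w hw
      obtain ⟨h, hh, rfl⟩ := hpt' z hz
      rw [← coords_mul, hpt]
      exact G.mul_mem hg hh
    · intro w hw
      obtain ⟨g, hg, rfl⟩ := hpt' w hw
      rw [← coords_inv, hpt]
      exact G.inv_mem hg
    · intro w hw
      obtain ⟨g, hg, rfl⟩ := hpt' w hw
      rw [hmap g hg, hpt]
      exact hmaps g hg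
    · intro w z hw hz
      obtain ⟨g, hg, rfl⟩ := hpt' w hw
      obtain ⟨h, hh, rfl⟩ := hpt' z hz
      rw [← coords_mul, hmap _ (G.mul_mem hg hh), hmap g hg, hmap h hh, ← coords_mul,
        hhom g hg h hh]
    · exact (hpt _).2 hx₀
    · exact fun j => (hpt _).2 (hc j)
    · intro t ht
      by_contra! hne
      choose e heG he using fun m => hpt' _ (ht m).1
      have hinj : Function.Injective e := by
        intro m m' hm
        by_contra hmm
        exact hne m m' hmm (by rw [← he, ← he, hm])
      have hsub : Set.range e ⊆ {g : GL (Fin n) k | g ∈ G ∧ g * x₀ * (F g)⁻¹ = x₀} := by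
        rintro _ ⟨m, rfl⟩
        refine ⟨heG m, (heq _ (heG m) _).2 ?_⟩
        rw [he]
        exact (ht m).2
      have h1 := Set.ncard_le_ncard hsub hS
      rw [Set.ncard_range_of_injective hinj] at h1
      simp at h1
      omega
    · intro w hw J hJ
      obtain ⟨x, hx, rfl⟩ := hpt' w hw
      obtain ⟨j, hj, g, hg, e⟩ := hcover x hx J hJ
      refine ⟨j, hj, coords g, (hpt g).2 hg, ?_⟩
      rw [(heq g hg _).1 e, coords_mul, coords_inv]
  intro x hx
  obtain ⟨w, hw, e⟩ := twistedLangSurjective_of_isAlgClosed hr k a _ _ hfam (coords x)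
    ((hpt x).2 hx)
  obtain ⟨g, hg, rfl⟩ := hpt' w hw
  exact ⟨g, hg, (heq g hg x).2 e⟩

open TopologicalSpace in
/-- A connected Noetherian space with transitive homeomorphism group is irreducible. -/
theorem preirreducibleSpace_of_homogeneous {X : Type*} [TopologicalSpace X] [NoetherianSpace X]
    [PreconnectedSpace X] (hX : ∀ x y : X, ∃ e : X ≃ₜ X, e x = y) : PreirreducibleSpace X := by
  rcases isEmpty_or_nonempty X with hemp | ⟨⟨x₁⟩⟩
  · exact ⟨fun U V _ _ ⟨x, _⟩ => hemp.elim x⟩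
  obtain ⟨o, ho, ⟨x, hxo⟩, hoZ⟩ :=
    NoetherianSpace.exists_isOpen_nonempty_subset_irreducibleComponent _
      (irreducibleComponent_mem_irreducibleComponents x₁)
  have hirr : IsPreirreducible o :=
    isIrreducible_irreducibleComponent.isPreirreducible.open_subset ho hoZ
  refine PreirreducibleSpace.of_forall_nonempty_inter fun U V hU hV hUne hVne => ?_
  have hclopen : IsClopen (closure U) := by
    refine ⟨isClosed_closure, isOpen_iff_mem_nhds.2 fun y hy => ?_⟩
    obtain ⟨e, rfl⟩ := hX x y
    have hW : IsOpen (e '' o) := e.isOpenMap o ho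
    have hWirr : IsPreirreducible (e '' o) := hirr.image e e.continuous.continuousOn
    have hmem : e x ∈ e '' o := ⟨x, hxo, rfl⟩
    have hne : (e '' o ∩ U).Nonempty := mem_closure_iff.1 hy _ hW hmem
    refine Filter.mem_of_superset (hW.mem_nhds hmem) ?_
    exact (subset_closure_inter_of_isPreirreducible_of_isOpen hWirr hU hne).trans
      (closure_mono Set.inter_subset_right)
  have hdense : Dense U := by
    rw [dense_iff_closure_eq]
    exact hclopen.eq_univ hUne.closure
  rw [Set.inter_comm]
  exact hdense.inter_open_nonempty V hV hVne

/-- A subalgebra of functions on a group that behaves like the coordinate ring of an affine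
algebraic group. -/
structure IsAffineGroupAlgebra {k X : Type} [Field k] [Group X] (A : Subalgebra k (X → k)) :
    Prop where
  fg : A.FG
  comul : ∀ f ∈ A, ∃ (ι : Type) (_ : Fintype ι) (u v : ι → X → k),
    (∀ i, u i ∈ A) ∧ (∀ i, v i ∈ A) ∧ ∀ x y, f (x * y) = ∑ i, u i x * v i y
  antipode : ∀ f ∈ A, (fun x => f x⁻¹) ∈ A
  exists_point : ∀ φ : A →ₐ[k] k, ∃ x : X, ∀ f : A, φ f = f.1 x

namespace IsAffineGroupAlgebra

variable {k X : Type} [Field k] [Group X] {A : Subalgebra k (X → k)}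

theorem mul_left (hA : IsAffineGroupAlgebra A) {f : X → k} (hf : f ∈ A) (y : X) :
    (fun x => f (y * x)) ∈ A := by
  obtain ⟨ι, _, u, v, hu, hv, h⟩ := hA.comul f hf
  have : (fun x => f (y * x)) = ∑ i, u i y • v i := by
    ext x
    simp [h]
  rw [this]
  exact sum_mem fun i _ => A.smul_mem (hv i) _

theorem mul_right (hA : IsAffineGroupAlgebra A) {f : X → k} (hf : f ∈ A) (y : X) :
    (fun x => f (x * y)) ∈ A := by
  obtain ⟨ι, _, u, v, hu, hv, h⟩ := hA.comul f hf
  have : (fun x => f (x * y)) = ∑ i, v i y • u i := by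
    ext x
    simp [h, mul_comm]
  rw [this]
  exact sum_mem fun i _ => A.smul_mem (hu i) _

/-- The point of the spectrum defined by evaluation at `x`. -/
def point (A : Subalgebra k (X → k)) (x : X) : PrimeSpectrum A :=
  ⟨RingHom.ker ((Pi.evalRingHom (fun _ => k) x).comp A.val.toRingHom), RingHom.ker_isPrime _⟩

theorem isDomain (hA : IsAffineGroupAlgebra A)
    (hconn : ∀ I J : Set A, (∀ x, (∀ f ∈ I, f.1 x = 0) ∨ ∀ f ∈ J, f.1 x = 0) →
      (∀ x, ¬ ((∀ f ∈ I, f.1 x = 0) ∧ ∀ f ∈ J, f.1 x = 0)) →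
      (∀ x, ¬ ∀ f ∈ I, f.1 x = 0) ∨ ∀ x, ¬ ∀ f ∈ J, f.1 x = 0) : IsDomain A := by
  let τ : TopologicalSpace X := .induced (point A) inferInstance
  have hind : Topology.IsInducing (point A) := ⟨rfl⟩
  have hclosed : ∀ S : Set X, IsClosed S ↔ ∃ I : Set A, S = {x | ∀ f ∈ I, f.1 x = 0} := by
    intro S
    rw [hind.isClosed_iff]
    constructor
    · rintro ⟨T, hT, rfl⟩
      obtain ⟨I, rfl⟩ := (PrimeSpectrum.isClosed_iff_zeroLocus _).1 hT
      exact ⟨I, rfl⟩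
    · rintro ⟨I, rfl⟩
      exact ⟨_, PrimeSpectrum.isClosed_zeroLocus I, rfl⟩
  have : Algebra.FiniteType k A := ⟨(Subalgebra.fg_top A).2 hA.fg⟩
  have : IsNoetherianRing A := Algebra.FiniteType.isNoetherianRing k A
  have : TopologicalSpace.NoetherianSpace X := hind.noetherianSpace
  have : PreconnectedSpace X := by
    refine ⟨isPreconnected_closed_iff.2 ?_⟩
    intro S T hS hT hST hSne hTne
    obtain ⟨I, rfl⟩ := (hclosed S).1 hS
    obtain ⟨J, rfl⟩ := (hclosed T).1 hT
    by_contra hne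
    obtain ⟨x, -, hx⟩ := hSne
    obtain ⟨y, -, hy⟩ := hTne
    rcases hconn I J (fun x => hST (Set.mem_univ x))
      (fun x hx => hne ⟨x, Set.mem_univ _, hx⟩) with h | h
    exacts [h x hx, h y hy]
  have hcont : ∀ y : X, Continuous fun x => y * x := by
    intro y
    refine continuous_iff_isClosed.2 fun S hS => ?_
    obtain ⟨I, rfl⟩ := (hclosed S).1 hS
    refine (hclosed _).2 ⟨(fun f : A => (⟨_, hA.mul_left f.2 y⟩ : A)) '' I, ?_⟩
    ext x
    simp only [Set.mem_preimage, Set.mem_ofPred_eq, Set.forall_mem_image]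
  have : PreirreducibleSpace X := preirreducibleSpace_of_homogeneous fun x y =>
    ⟨⟨Equiv.mulLeft (y * x⁻¹), hcont _, hcont _⟩, by simp⟩
  have hmul : ∀ f g : A, f * g = 0 → f = 0 ∨ g = 0 := by
    intro f g hfg
    by_contra! hne
    have hopen : ∀ f : A, IsOpen {x | f.1 x ≠ 0} := by
      intro f
      rw [← isClosed_compl_iff, hclosed]
      exact ⟨{f}, by ext; simp⟩
    have hnonempty : ∀ f : A, f ≠ 0 → {x | f.1 x ≠ 0}.Nonempty := by
      intro f hf
      by_contra! h
      apply hf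
      ext x
      by_contra hx
      exact (Set.eq_empty_iff_forall_notMem.1 h x) hx
    obtain ⟨x, hx, hx'⟩ := nonempty_preirreducible_inter (hopen f) (hopen g)
      (hnonempty f hne.1) (hnonempty g hne.2)
    have := congrFun (congrArg Subtype.val hfg) x
    exact mul_ne_zero hx hx' this
  have : NoZeroDivisors A := ⟨fun {f g} => hmul f g⟩
  exact NoZeroDivisors.to_isDomain A

end IsAffineGroupAlgebra

section CoordinateRing

variable {k : Type} [Field k] {n : ℕ} (G : Subgroup (GL (Fin n) k))

/-- The coordinate functions on a linear group. -/
def coordFun (i : Coord n) : G → k := fun g => coords (g : GL (Fin n) k) i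

/-- The algebra of regular functions on a linear group. -/
def regularFunctions : Subalgebra k (G → k) := Algebra.adjoin k (Set.range (coordFun G))

theorem aeval_coordFun (P : MvPolynomial (Coord n) k) (g : G) :
    MvPolynomial.aeval (coordFun G) P g = MvPolynomial.eval (coords (g : GL (Fin n) k)) P := by
  induction P using MvPolynomial.induction_on with
  | C a => simp
  | add p q hp hq => simp [hp, hq]
  | mul_X p i hp => simp [hp, coordFun]

theorem mem_regularFunctions {f : G → k} : f ∈ regularFunctions G ↔
    ∃ P : MvPolynomial (Coord n) k, ∀ g : G,
      f g = MvPolynomial.eval (coords (g : GL (Fin n) k)) P := by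
  rw [regularFunctions, Algebra.adjoin_range_eq_range_aeval]
  constructor
  · rintro ⟨P, rfl⟩
    exact ⟨P, fun g => aeval_coordFun G P g⟩
  · rintro ⟨P, hP⟩
    exact ⟨P, funext fun g => by simp [hP, aeval_coordFun]⟩

variable {G}

theorem coordFun_mem (i : Coord n) : coordFun G i ∈ regularFunctions G :=
  Algebra.subset_adjoin ⟨i, rfl⟩

theorem comp_mem_regularFunctions {X : Type} {A : Subalgebra k (X → k)} {φ : X → G}
    (hφ : ∀ i, (fun x => coords (φ x : GL (Fin n) k) i) ∈ A) {f : G → k}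
    (hf : f ∈ regularFunctions G) : f ∘ φ ∈ A := by
  induction hf using Algebra.adjoin_induction with
  | mem f hf =>
    obtain ⟨i, rfl⟩ := hf
    exact hφ i
  | algebraMap r => exact A.algebraMap_mem r
  | add f g _ _ hf hg => exact A.add_mem hf hg
  | mul f g _ _ hf hg => exact A.mul_mem hf hg

theorem isAffineGroupAlgebra_regularFunctions (hG : IsZClosed (G : Set (GL (Fin n) k))) :
    IsAffineGroupAlgebra (regularFunctions G) where
  fg := Subalgebra.fg_def.2 ⟨_, Set.finite_range _, rfl⟩
  comul f hf := by
    induction hf using Algebra.adjoin_induction with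
    | mem f hf =>
      obtain ⟨i, rfl⟩ := hf
      rcases i with i | i
      · refine ⟨Fin n, inferInstance, fun l => coordFun G (.inl (i.1, l)),
          fun l => coordFun G (.inl (l, i.2)), fun l => coordFun_mem _,
          fun l => coordFun_mem _, ?_⟩
        intro x y
        simp only [coordFun, Subgroup.coe_mul, coords_mul]
        rfl
      · refine ⟨Fin n, inferInstance, fun l => coordFun G (.inr (l, i.2)),
          fun l => coordFun G (.inr (i.1, l)), fun l => coordFun_mem _,
          fun l => coordFun_mem _, ?_⟩
        intro x y
        simp only [coordFun, Subgroup.coe_mul, coords_mul]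
        simp only [coordMul, Sum.elim_inr]
        exact Finset.sum_congr rfl fun l _ => mul_comm (_ : k) _
    | algebraMap r =>
      exact ⟨Unit, inferInstance, fun _ _ => r, fun _ _ => 1,
        fun _ => Subalgebra.algebraMap_mem _ r, fun _ => Subalgebra.one_mem _, fun x y => by simp⟩
    | add f g _ _ hf hg =>
      obtain ⟨ι, _, u, v, hu, hv, h⟩ := hf
      obtain ⟨κ, _, u', v', hu', hv', h'⟩ := hg
      refine ⟨ι ⊕ κ, inferInstance, Sum.elim u u', Sum.elim v v', ?_, ?_, ?_⟩
      · rintro (i | i); exacts [hu i, hu' i]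
      · rintro (i | i); exacts [hv i, hv' i]
      · intro x y; simp [h, h']
    | mul f g _ _ hf hg =>
      obtain ⟨ι, _, u, v, hu, hv, h⟩ := hf
      obtain ⟨κ, _, u', v', hu', hv', h'⟩ := hg
      refine ⟨ι × κ, inferInstance, fun i => u i.1 * u' i.2, fun i => v i.1 * v' i.2,
        fun i => mul_mem (hu _) (hu' _), fun i => mul_mem (hv _) (hv' _), ?_⟩
      intro x y
      simp only [Pi.mul_apply, h, h', Finset.sum_mul_sum, Fintype.sum_prod_type]
      exact Finset.sum_congr rfl fun i _ => Finset.sum_congr rfl fun j _ => by ring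
  antipode f hf := by
    refine comp_mem_regularFunctions (φ := fun x => x⁻¹) (fun i => ?_) hf
    simp only [Subgroup.coe_inv, coords_inv]
    exact coordFun_mem _
  exists_point φ := by
    obtain ⟨I, hI⟩ := hG
    let w : Coord n → k := fun i => φ ⟨coordFun G i, coordFun_mem i⟩
    have hφ : ∀ f : regularFunctions G, ∀ P : MvPolynomial (Coord n) k,
        (∀ g : G, f.1 g = MvPolynomial.eval (coords (g : GL (Fin n) k)) P) →
        φ f = MvPolynomial.eval w P := by
      intro f P hP
      have h1 : f = MvPolynomial.aeval (fun i => (⟨coordFun G i, coordFun_mem i⟩ :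
          regularFunctions G)) P := by
        apply Subtype.ext
        ext g
        have h2 : MvPolynomial.aeval (coordFun G) = (regularFunctions G).val.comp
            (MvPolynomial.aeval fun i => (⟨coordFun G i, coordFun_mem i⟩ :
              regularFunctions G)) :=
          MvPolynomial.algHom_ext fun i => by simp
        rw [hP, ← aeval_coordFun, h2]
        rfl
      rw [h1, ← AlgHom.comp_apply, MvPolynomial.comp_aeval, MvPolynomial.aeval_eq_eval]
    have hw : coordMul w (coordInv w) = coordOne k n := by
      ext i
      have h1 : ∀ P : MvPolynomial (Coord n) k,
          (∀ g : G, MvPolynomial.eval (coords (g : GL (Fin n) k)) P = 0) →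
          MvPolynomial.eval w P = 0 := by
        intro P hP
        rw [← hφ 0 P fun g => (hP g).symm, map_zero]
      have h2 := fun g : G => congrFun (coordMul_coordInv_coords (g : GL (Fin n) k)) i
      rcases i with i | i
      · have h3 := h1 ((∑ l, X (.inl (i.1, l)) * X (.inr (l, i.2))) - C (coordOne k n (.inl i)))
          fun g => by
            have := h2 g
            rw [← sub_eq_zero] at this
            simpa [coordMul, coordInv] using this
        rw [← sub_eq_zero]
        simpa [coordMul, coordInv] using h3
      · have h3 := h1 ((∑ l, X (.inl (i.1, l)) * X (.inr (l, i.2))) - C (coordOne k n (.inr i)))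
          fun g => by
            have := h2 g
            rw [← sub_eq_zero] at this
            simpa [coordMul, coordInv] using this
        rw [← sub_eq_zero]
        simpa [coordMul, coordInv] using h3
    obtain ⟨g, hg⟩ := exists_coords_eq hw
    have hgG : g ∈ G := by
      rw [← SetLike.mem_coe, hI]
      intro P hP
      rw [hg, ← hφ 0 P, map_zero]
      intro h
      have : (h : GL (Fin n) k) ∈ (G : Set (GL (Fin n) k)) := h.2
      rw [hI] at this
      exact (this P hP).symm
    refine ⟨⟨g, hgG⟩, fun f => ?_⟩
    obtain ⟨P, hP⟩ := (mem_regularFunctions G).1 f.2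
    rw [hφ f P hP, hP, hg]

theorem isDomain_regularFunctions (hG : IsZClosed (G : Set (GL (Fin n) k)))
    (hconn : IsZConnected (G : Set (GL (Fin n) k))) : IsDomain (regularFunctions G) := by
  refine (isAffineGroupAlgebra_regularFunctions hG).isDomain fun I J hIJ hdisj => ?_
  choose P hP using fun f : regularFunctions G => (mem_regularFunctions G).1 f.2
  have key : ∀ (I : Set (regularFunctions G)) (g : G),
      (g : GL (Fin n) k) ∈ {g | ∀ Q ∈ P '' I, MvPolynomial.eval (coords g) Q = 0} ↔
        ∀ f ∈ I, f.1 g = 0 := by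
    intro I g
    simp only [hP]
    exact Set.forall_mem_image
  rcases hconn _ _ ⟨P '' I, rfl⟩ ⟨P '' J, rfl⟩
    (fun g hg => (hIJ ⟨g, hg⟩).imp (key I ⟨g, hg⟩).2 (key J ⟨g, hg⟩).2)
    (Set.eq_empty_of_forall_notMem fun g ⟨hg, hg1, hg2⟩ =>
      hdisj ⟨g, hg⟩ ⟨(key I ⟨g, hg⟩).1 hg1, (key J ⟨g, hg⟩).1 hg2⟩) with h | h
  · exact Or.inl fun x hx => Set.eq_empty_iff_forall_notMem.1 h x ⟨x.2, (key I x).2 hx⟩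
  · exact Or.inr fun x hx => Set.eq_empty_iff_forall_notMem.1 h x ⟨x.2, (key J x).2 hx⟩

end CoordinateRing

section Extension

variable {k R A : Type*} [Field k] [CommRing R] [IsDomain R] [CommRing A]

/-- A constructible subset of the spectrum of a domain that contains the generic point contains a
nonempty basic open set. -/
theorem PrimeSpectrum.exists_basicOpen_subset_of_bot_mem {s : Set (PrimeSpectrum R)}
    (hs : Topology.IsConstructible s) (hbot : ⊥ ∈ s) :
    ∃ r : R, r ≠ 0 ∧ (PrimeSpectrum.basicOpen r : Set (PrimeSpectrum R)) ⊆ s := by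
  obtain ⟨S, rfl⟩ := PrimeSpectrum.exists_constructibleSetData_iff.2 hs
  simp only [PrimeSpectrum.ConstructibleSetData.toSet, Set.mem_iUnion,
    PrimeSpectrum.BasicConstructibleSetData.toSet] at hbot ⊢
  obtain ⟨C, hC, hg, hf⟩ := hbot
  refine ⟨C.f, fun h => hf ?_, fun p hp => Set.mem_iUnion₂.2 ⟨C, hC, ?_, ?_⟩⟩
  · simp [h]
  · rintro _ ⟨i, rfl⟩
    have : C.g i ∈ (⊥ : Ideal R) := hg ⟨i, rfl⟩
    rw [Ideal.mem_bot.1 this]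
    exact p.asIdeal.zero_mem
  · simpa [PrimeSpectrum.mem_zeroLocus] using hp

variable [Algebra k R] [Algebra k A]

/-- Over an algebraically closed field, a generic rational point lifts along a dominant morphism of
finite type, and the lift can be chosen outside a given hypersurface. -/
theorem exists_ne_zero_forall_exists_extension [IsAlgClosed k] [IsDomain A]
    [Algebra.FiniteType k R] [Algebra.FiniteType k A]
    (f : R →ₐ[k] A) (hf : Function.Injective f) {a : A} (ha : a ≠ 0) :
    ∃ r : R, r ≠ 0 ∧ ∀ φ : R →ₐ[k] k, φ r ≠ 0 →
      ∃ ψ : A →ₐ[k] k, ψ.comp f = φ ∧ ψ a ≠ 0 := by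
  let _ : Algebra R A := f.toRingHom.toAlgebra
  have : IsScalarTower k R A := .of_algebraMap_eq fun x => (f.commutes x).symm
  have hinj : Function.Injective (algebraMap R A) := hf
  let A' := Localization.Away a
  have hA' : Function.Injective (algebraMap A A') :=
    IsLocalization.injective A' (powers_le_nonZeroDivisors_of_noZeroDivisors ha)
  have : IsDomain A' :=
    IsLocalization.isDomain_localization (powers_le_nonZeroDivisors_of_noZeroDivisors ha)
  have : Algebra.FiniteType A A' := IsLocalization.finiteType_of_monoid_fg (Submonoid.powers a) A'
  have : Algebra.FiniteType k A' := .trans (S := A) inferInstance inferInstance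
  have : IsScalarTower k R A' := .of_algebraMap_eq fun x => by
    rw [IsScalarTower.algebraMap_apply R A A', ← IsScalarTower.algebraMap_apply k R A,
      ← IsScalarTower.algebraMap_apply k A A']
  have : Algebra.FiniteType R A' := .of_restrictScalars_finiteType k R A'
  have : IsNoetherianRing R := Algebra.FiniteType.isNoetherianRing k R
  have hinj' : Function.Injective (algebraMap R A') := by
    rw [IsScalarTower.algebraMap_eq R A A']
    exact hA'.comp hinj
  obtain ⟨r, hr, hsub⟩ := PrimeSpectrum.exists_basicOpen_subset_of_bot_mem
    (PrimeSpectrum.isConstructible_range_comap (f := algebraMap R A')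
      (RingHom.FinitePresentation.of_finiteType.1
        (RingHom.finiteType_algebraMap.2 inferInstance)))
    ⟨⊥, PrimeSpectrum.ext (by
      rw [PrimeSpectrum.comap_asIdeal]
      exact Ideal.comap_bot_of_injective _ hinj')⟩
  refine ⟨r, hr, fun φ hφ => ?_⟩
  have hφsurj : Function.Surjective φ := fun c => ⟨algebraMap k R c, by simp⟩
  have hmax : (RingHom.ker φ).IsMaximal := RingHom.ker_isMaximal_of_surjective φ hφsurj
  obtain ⟨q, hq⟩ := hsub (a := ⟨RingHom.ker φ, inferInstance⟩) hφ
  obtain ⟨m, hm, hqm⟩ := Ideal.exists_le_maximal q.asIdeal q.2.ne_top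
  have hker : RingHom.ker φ ≤ m.comap (algebraMap R A') := by
    have := congrArg PrimeSpectrum.asIdeal hq
    rw [PrimeSpectrum.comap_asIdeal] at this
    exact this.symm.le.trans (Ideal.comap_mono hqm)
  let _ : Field (A' ⧸ m) := Ideal.Quotient.field m
  have : Algebra.FiniteType k (A' ⧸ m) := inferInstance
  have : Module.Finite k (A' ⧸ m) := finite_of_finite_type_of_isJacobsonRing k (A' ⧸ m)
  let e : k ≃ₐ[k] (A' ⧸ m) := AlgEquiv.ofBijective (Algebra.ofId k (A' ⧸ m))
    (IsAlgClosed.algebraMap_bijective_of_isIntegral)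
  let ψ' : A' →ₐ[k] k := (e.symm : (A' ⧸ m) →ₐ[k] k).comp (Ideal.Quotient.mkₐ k m)
  refine ⟨ψ'.comp (IsScalarTower.toAlgHom k A A'), AlgHom.ext fun x => ?_, ?_⟩
  · have hx : x - algebraMap k R (φ x) ∈ RingHom.ker φ := by simp [RingHom.mem_ker]
    have h2 : ψ' (algebraMap R A' (x - algebraMap k R (φ x))) = 0 := by
      have := Ideal.Quotient.eq_zero_iff_mem.2 (Ideal.mem_comap.1 (hker hx))
      simp only [ψ', AlgHom.comp_apply, Ideal.Quotient.mkₐ_eq_mk]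
      rw [this, map_zero]
    rw [map_sub, map_sub, sub_eq_zero, ← IsScalarTower.algebraMap_apply k R A',
      AlgHom.commutes] at h2
    rw [IsScalarTower.algebraMap_apply R A A'] at h2
    exact h2
  · exact ((IsLocalization.Away.algebraMap_isUnit (S := A') a).map ψ').ne_zero

/-- A generic rational point has infinitely many lifts along a morphism of finite type that is
generically of positive relative dimension. -/
theorem exists_ne_zero_forall_infinite_extension [IsAlgClosed k] [IsDomain A]
    [Algebra.FiniteType k R] [Algebra.FiniteType k A] [Algebra R A] [IsScalarTower k R A]
    {x : A} (hx : Transcendental R x) :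
    ∃ b : R, b ≠ 0 ∧ ∀ φ : R →ₐ[k] k, φ b ≠ 0 →
      {c | ∃ ψ : A →ₐ[k] k, (∀ y, ψ (algebraMap R A y) = φ y) ∧ ψ x = c}.Infinite := by
  have : Algebra.FiniteType k (Polynomial R) := .trans (S := R) inferInstance inferInstance
  let e : Polynomial R →ₐ[k] A := (Polynomial.aeval x).restrictScalars k
  have he : Function.Injective e := transcendental_iff_injective.1 hx
  obtain ⟨r, hr, hext⟩ := exists_ne_zero_forall_exists_extension e he (one_ne_zero (α := A))
  refine ⟨r.leadingCoeff, Polynomial.leadingCoeff_ne_zero.2 hr, fun φ hφ => ?_⟩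
  have hr' : r.map φ.toRingHom ≠ 0 :=
    fun h => hφ ((Polynomial.coeff_map φ.toRingHom _).symm.trans (by rw [h]; simp))
  have hinf : {c | (r.map φ.toRingHom).eval c ≠ 0}.Infinite := by
    refine ((r.map φ.toRingHom).roots.finite_toSet.infinite_compl).mono fun c hc => ?_
    exact fun h => hc ((Polynomial.mem_roots hr').2 h)
  refine hinf.mono fun c hc => ?_
  let Φ : Polynomial R →ₐ[k] k :=
    { Polynomial.eval₂RingHom φ.toRingHom c with
      commutes' := fun a => by simp [Polynomial.algebraMap_apply] }
  have hΦ : ∀ P, Φ P = P.eval₂ φ.toRingHom c := fun P => rfl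
  obtain ⟨ψ, hψ, -⟩ := hext Φ (by rwa [hΦ, ← Polynomial.eval_map])
  refine ⟨ψ, fun y => ?_, ?_⟩
  · simpa [hΦ, e] using DFunLike.congr_fun hψ (Polynomial.C y)
  · simpa [hΦ, e] using DFunLike.congr_fun hψ Polynomial.X

end Extension

section Algebraicity

variable {k A : Type*} [Field k] [CommRing A] [IsDomain A] [Algebra k A] [Algebra.FiniteType k A]

/-- A domain of finite type is algebraic over the range of an injective endomorphism. -/
theorem AlgHom.isAlgebraic_range_of_injective (f : A →ₐ[k] A) (hf : Function.Injective f) :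
    Algebra.IsAlgebraic f.range A := by
  obtain ⟨ι, x, hx⟩ := exists_isTranscendenceBasis' k A
  have hfx : IsTranscendenceBasis k (f ∘ x) :=
    (hx.1.map' hf).isTranscendenceBasis_of_trdeg_le trdeg_lt_aleph0_of_finiteType
      hx.cardinalMk_eq_trdeg.ge
  have hle : Algebra.adjoin k (Set.range (f ∘ x)) ≤ f.range :=
    Algebra.adjoin_le (by rintro _ ⟨i, rfl⟩; exact ⟨x i, rfl⟩)
  have := hfx.isAlgebraic
  refine ⟨fun a => ?_⟩
  obtain ⟨p, hp, hpa⟩ := this.isAlgebraic a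
  refine ⟨p.map (Subalgebra.inclusion hle).toRingHom, ?_, ?_⟩
  · exact (Polynomial.map_ne_zero_iff (Subalgebra.inclusion_injective hle)).2 hp
  · rw [← hpa, Polynomial.aeval_def, Polynomial.eval₂_map]
    rfl

/-- An endomorphism of a domain of finite type that is algebraic over the range is injective. -/
theorem AlgHom.injective_of_isAlgebraic_range (f : A →ₐ[k] A) [Algebra.IsAlgebraic f.range A] :
    Function.Injective f := by
  obtain ⟨ι, x, hx⟩ := exists_isTranscendenceBasis' k f.range
  choose y hy using fun i => (x i).2
  have hx' : IsTranscendenceBasis k (f ∘ y) := by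
    have := hx.algebraMap_comp (A := A)
    rwa [show (algebraMap f.range A ∘ x) = f ∘ y from funext fun i => (hy i).symm] at this
  have hyb : IsTranscendenceBasis k y :=
    (AlgebraicIndependent.of_comp f hx'.1).isTranscendenceBasis_of_trdeg_le
      trdeg_lt_aleph0_of_finiteType hx'.cardinalMk_eq_trdeg.ge
  have := hyb.isAlgebraic
  rw [injective_iff_map_eq_zero]
  intro a ha
  by_contra hne
  refine Ideal.comap_ne_bot_of_algebraic_mem (R := Algebra.adjoin k (Set.range y))
    (I := RingHom.ker f) hne ha (this.isAlgebraic a) ?_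
  rw [eq_bot_iff]
  rintro ⟨b, hb⟩ hb0
  have hb0 : f b = 0 := hb0
  rw [Algebra.adjoin_range_eq_range_aeval] at hb
  obtain ⟨P, rfl⟩ := hb
  have h0 : MvPolynomial.aeval (f ∘ y) P = 0 := by
    rw [← hb0]
    exact (DFunLike.congr_fun (MvPolynomial.comp_aeval (R := k) y f) P).symm
  have hP : P = 0 := hx'.1.eq_zero_of_aeval_eq_zero _ h0
  subst hP
  exact Subtype.ext (map_zero _)

end Algebraicity

section Dominance

variable {k X : Type} [Field k] {A : Subalgebra k (X → k)}

/-- Evaluation at a point, as a homomorphism on an algebra of functions. -/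
def evalAlgHom (A : Subalgebra k (X → k)) (x : X) : A →ₐ[k] k :=
  (Pi.evalAlgHom k (fun _ => k) x).comp A.val

@[simp]
theorem evalAlgHom_apply (x : X) (f : A) : evalAlgHom A x f = f.1 x := rfl

/-- The comorphism of a regular map. -/
def comorphism {L : X → X} (hL : ∀ f ∈ A, f ∘ L ∈ A) : A →ₐ[k] A where
  toFun f := ⟨f.1 ∘ L, hL _ f.2⟩
  map_one' := rfl
  map_mul' _ _ := rfl
  map_zero' := rfl
  map_add' _ _ := rfl
  commutes' _ := rfl

theorem exists_apply_ne_zero {f : A} (hf : f ≠ 0) : ∃ x, f.1 x ≠ 0 := by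
  by_contra! h
  exact hf (Subtype.ext (funext h))

theorem comorphism_injective_of_surjective {L : X → X} (hL : ∀ f ∈ A, f ∘ L ∈ A)
    (hsurj : Function.Surjective L) : Function.Injective (comorphism hL) := by
  rw [injective_iff_map_eq_zero]
  intro f hf
  ext x
  obtain ⟨y, rfl⟩ := hsurj x
  exact congrFun (congrArg Subtype.val hf) y

/-- If the coordinate ring is algebraic over the image of the comorphism, then a fibre over a
generic point of the image is finite. -/
theorem exists_finite_fibre [IsDomain A] (hfg : A.FG)
    (hsep : ∀ x y : X, (∀ f ∈ A, f x = f y) → x = y) {L : X → X} (hL : ∀ f ∈ A, f ∘ L ∈ A)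
    (halg : Algebra.IsAlgebraic (comorphism hL).range A) :
    ∃ g, {h | L h = L g}.Finite := by
  obtain ⟨t, ht⟩ := hfg
  have htA : ∀ f ∈ t, f ∈ A := fun f hf => ht ▸ Algebra.subset_adjoin hf
  choose p hp hpf using fun f : A => halg.isAlgebraic f
  have hprod : (∏ f : t, ((p ⟨f, htA f f.2⟩).leadingCoeff : A)) ≠ 0 :=
    Finset.prod_ne_zero_iff.2 fun f _ h =>
      Polynomial.leadingCoeff_ne_zero.2 (hp _) (Subtype.ext h)
  obtain ⟨g, hg⟩ := exists_apply_ne_zero hprod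
  have hlead : ∀ f : t, ((p ⟨f, htA f f.2⟩).leadingCoeff : A).1 g ≠ 0 := by
    intro f hf
    apply hg
    rw [← evalAlgHom_apply, map_prod]
    exact Finset.prod_eq_zero (Finset.mem_univ f) hf
  refine ⟨g, ?_⟩
  let q : A → Polynomial k := fun f =>
    (p f).map ((evalAlgHom A g).comp (comorphism hL).range.val).toRingHom
  have hq : ∀ f : t, q ⟨f, htA f f.2⟩ ≠ 0 := fun f =>
    fun h => hlead f ((Polynomial.coeff_map _ _).symm.trans
      ((congrArg (fun P => Polynomial.coeff P _) h).trans (Polynomial.coeff_zero _)))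
  have hroot : ∀ h, L h = L g → ∀ f : A, (q f).eval (f.1 h) = 0 := by
    intro h hh f
    have h1 : (evalAlgHom A g).comp (comorphism hL).range.val =
        (evalAlgHom A h).comp (comorphism hL).range.val := by
      ext ⟨_, b, rfl⟩
      exact congrArg b.1 hh.symm
    have h2 := congrArg (evalAlgHom A h) (hpf f)
    rw [map_zero, Polynomial.aeval_def, ← AlgHom.coe_toRingHom, Polynomial.hom_eval₂] at h2
    simp only [q, h1, Polynomial.eval_map]
    exact h2
  have hinj : Set.InjOn (fun h (f : t) => f.1 h) {h | L h = L g} := by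
    intro x _ y _ hxy
    refine hsep x y fun f hf => ?_
    rw [← ht] at hf
    induction hf using Algebra.adjoin_induction with
    | mem f hf => exact congrFun hxy ⟨f, hf⟩
    | algebraMap r => rfl
    | add f g _ _ hf hg => exact congrArg₂ (· + ·) hf hg
    | mul f g _ _ hf hg => exact congrArg₂ (· * ·) hf hg
  refine Set.Finite.of_finite_image (Set.Finite.subset (Set.Finite.pi'
    (t := fun f : t => {c | c ∈ (q ⟨f, htA f f.2⟩).roots}) fun f => ?_) ?_) hinj
  · exact (q ⟨f, htA f f.2⟩).roots.finite_toSet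
  · rintro _ ⟨h, hh, rfl⟩ f
    exact (Polynomial.mem_roots (hq f)).2 (hroot h hh ⟨f, htA f f.2⟩)

variable [Group X]

/-- If all fibres are finite, the coordinate ring is algebraic over the image of the
comorphism. -/
theorem isAlgebraic_range_comorphism [IsAlgClosed k] [IsDomain A] (hA : IsAffineGroupAlgebra A)
    (hsep : ∀ x y : X, (∀ f ∈ A, f x = f y) → x = y) {L : X → X} (hL : ∀ f ∈ A, f ∘ L ∈ A)
    (hfin : ∀ g, {h | L h = L g}.Finite) : Algebra.IsAlgebraic (comorphism hL).range A := by
  refine ⟨fun x => ?_⟩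
  by_contra hx
  have : Algebra.FiniteType k A := ⟨(Subalgebra.fg_top A).2 hA.fg⟩
  have : Algebra.FiniteType k (comorphism hL).range :=
    .of_surjective (comorphism hL).rangeRestrict (comorphism hL).rangeRestrict_surjective
  obtain ⟨b, hb, hext⟩ := exists_ne_zero_forall_infinite_extension (k := k) hx
  obtain ⟨g, hg⟩ := exists_apply_ne_zero (A := A) (f := b) fun h => hb (Subtype.ext h)
  refine hext ((evalAlgHom A g).comp (comorphism hL).range.val) hg
    (((hfin g).image x.1).subset ?_)
  rintro _ ⟨ψ, hψ, rfl⟩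
  obtain ⟨h, hh⟩ := hA.exists_point ψ
  refine ⟨h, hsep _ _ fun f hf => ?_, (hh x).symm⟩
  have := hψ ⟨comorphism hL ⟨f, hf⟩, ⟨f, hf⟩, rfl⟩
  rw [hh] at this
  exact this

/-- If all fibres are finite, the image contains a nonempty principal open subset. -/
theorem exists_ne_zero_forall_mem_range [IsAlgClosed k] [IsDomain A] (hA : IsAffineGroupAlgebra A)
    (hsep : ∀ x y : X, (∀ f ∈ A, f x = f y) → x = y) {L : X → X} (hL : ∀ f ∈ A, f ∘ L ∈ A)
    (hfin : ∀ g, {h | L h = L g}.Finite) :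
    ∃ f ∈ A, f ≠ 0 ∧ ∀ y, f y ≠ 0 → ∃ g, L g = y := by
  have := isAlgebraic_range_comorphism hA hsep hL hfin
  have : Algebra.FiniteType k A := ⟨(Subalgebra.fg_top A).2 hA.fg⟩
  obtain ⟨r, hr, hext⟩ := exists_ne_zero_forall_exists_extension (comorphism hL)
    (comorphism hL).injective_of_isAlgebraic_range (one_ne_zero (α := A))
  refine ⟨r.1, r.2, fun h => hr (Subtype.ext h), fun y hy => ?_⟩
  obtain ⟨ψ, hψ, -⟩ := hext (evalAlgHom A y) hy
  obtain ⟨g, hg⟩ := hA.exists_point ψ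
  refine ⟨g, hsep _ _ fun f hf => ?_⟩
  have := DFunLike.congr_fun hψ ⟨f, hf⟩
  rw [AlgHom.comp_apply, hg] at this
  exact this

end Dominance

section GeneralPosition

variable {k X : Type} [Field k] {A : Subalgebra k (X → k)}

/-- A map to a finite-dimensional space with components in a domain of functions takes some value
outside any given finite family of subspaces that do not contain its image. -/
theorem exists_forall_notMem_of_isDomain [IsDomain A] {ι κ : Type*} [Fintype ι] {w : X → ι → k}
    (hw : ∀ i, (fun x => w x i) ∈ A) (s : Finset κ) (V : κ → Submodule k (ι → k))
    (hV : ∀ i ∈ s, ∃ x, w x ∉ V i) : ∃ x, ∀ i ∈ s, w x ∉ V i := by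
  classical
  have h : ∀ i, ∃ f : A, (i ∈ s → f ≠ 0) ∧ ∀ x, w x ∈ V i → f.1 x = 0 := by
    intro i
    by_cases hi : i ∈ s
    · obtain ⟨x, hx⟩ := hV i hi
      obtain ⟨l, hlx, hl⟩ := Submodule.exists_le_ker_of_notMem hx
      have hmem : (fun x => l (w x)) ∈ A := by
        have : (fun x => l (w x)) = ∑ i, l (fun j => if i = j then 1 else 0) • fun x => w x i := by
          ext x
          rw [LinearMap.pi_apply_eq_sum_univ l (w x)]
          simp [Finset.sum_apply, mul_comm]
        rw [this]
        exact sum_mem fun i _ => A.smul_mem (hw i) _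
      exact ⟨⟨_, hmem⟩, fun _ h0 => hlx (congrFun (congrArg Subtype.val h0) x),
        fun y hy => hl hy⟩
    · exact ⟨0, fun h => absurd h hi, fun x _ => rfl⟩
  choose f hf0 hf using h
  obtain ⟨x, hx⟩ := exists_apply_ne_zero (Finset.prod_ne_zero_iff.2 fun i hi => hf0 i hi)
  refine ⟨x, fun i hi hxi => hx ?_⟩
  rw [← evalAlgHom_apply, map_prod]
  exact Finset.prod_eq_zero hi (hf i x hxi)

/-- Points in general position with respect to a map to a finite-dimensional space: large subsets
of them span as much as the whole image. -/
theorem exists_general_position [IsDomain A] {ι κ : Type*} [Fintype ι] [DecidableEq κ]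
    {w : X → ι → k} (hw : ∀ i, (fun x => w x i) ∈ A) (s : Finset κ) :
    ∃ c : κ → X, ∀ J ⊆ s, (∀ x, w x ∈ Submodule.span k ((fun j => w (c j)) '' J)) ∨
      J.card ≤ Module.finrank k (Submodule.span k ((fun j => w (c j)) '' J)) := by
  classical
  induction s using Finset.induction_on with
  | empty =>
    have : Nonempty X := by
      by_contra h
      rw [not_nonempty_iff] at h
      exact one_ne_zero (α := A) (Subtype.ext (funext fun x => h.elim x))
    refine ⟨fun _ => Classical.arbitrary X, fun J hJ => Or.inr ?_⟩
    simp [Finset.subset_empty.1 hJ]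
  | insert a s ha ih =>
    obtain ⟨c, hc⟩ := ih
    obtain ⟨x, hx⟩ := exists_forall_notMem_of_isDomain hw
      (s.powerset.filter fun J : Finset κ =>
        ∃ x, w x ∉ Submodule.span k ((fun j => w (c j)) '' (J : Set κ)))
      (fun J : Finset κ => Submodule.span k ((fun j => w (c j)) '' (J : Set κ)))
      (fun J hJ => (Finset.mem_filter.1 hJ).2)
    refine ⟨Function.update c a x, fun J hJ => ?_⟩
    have himage : ∀ J ⊆ s, (fun j => w (Function.update c a x j)) '' (J : Set κ) =
        (fun j => w (c j)) '' J := fun J hJ => Set.image_congr fun j hj => by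
      rw [Function.update_of_ne (ne_of_mem_of_not_mem (hJ hj) ha)]
    by_cases haJ : a ∈ J
    · have hJs : J.erase a ⊆ s := Finset.subset_insert_iff.1 hJ
      have hspan : (fun j => w (Function.update c a x j)) '' (J : Set κ) =
          insert (w x) ((fun j => w (c j)) '' (J.erase a)) := by
        rw [← himage _ hJs]
        conv_lhs => rw [← Finset.insert_erase haJ, Finset.coe_insert, Set.image_insert_eq]
        simp
      rw [hspan]
      by_cases hall : ∀ x, w x ∈ Submodule.span k ((fun j => w (c j)) '' (J.erase a : Set κ))
      · exact Or.inl fun y => Submodule.span_mono (Set.subset_insert _ _) (hall y)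
      · right
        have hxJ := hx (J.erase a)
          (Finset.mem_filter.2 ⟨Finset.mem_powerset.2 hJs, not_forall.1 hall⟩)
        have h1 := (hc _ hJs).resolve_left hall
        have hlt : Submodule.span k ((fun j => w (c j)) '' (J.erase a : Set κ)) <
            Submodule.span k (insert (w x) ((fun j => w (c j)) '' (J.erase a : Set κ))) :=
          lt_of_le_of_ne (Submodule.span_mono (Set.subset_insert _ _)) fun h =>
            hxJ (h ▸ Submodule.subset_span (Set.mem_insert _ _))
        have h2 := Submodule.finrank_lt_finrank_of_lt hlt
        have h3 := Finset.card_erase_add_one haJ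
        omega
    · have hJs : J ⊆ s := (Finset.subset_insert_iff_of_notMem haJ).1 hJ
      rw [himage J hJs]
      exact hc J hJs

/-- Finitely many translates of a nonempty principal open subset of an irreducible group, chosen
in general position, cover the group with high multiplicity. -/
theorem IsAffineGroupAlgebra.exists_translates_cover [Group X] [IsDomain A]
    (hA : IsAffineGroupAlgebra A) {f : X → k} (hf : f ∈ A) (hf0 : f ≠ 0) :
    ∃ d : ℕ, ∀ r : ℕ, ∃ c : Fin r → X, ∀ x, ∀ J : Finset (Fin r), d < J.card →
      ∃ j ∈ J, f (x * (c j)⁻¹) ≠ 0 := by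
  obtain ⟨ι, _, u, v, -, hv, huv⟩ := hA.comul f hf
  refine ⟨Fintype.card ι, fun r => ?_⟩
  obtain ⟨c, hc⟩ := exists_general_position (w := fun x i => v i x⁻¹)
    (fun i => hA.antipode _ (hv i)) (Finset.univ : Finset (Fin r))
  refine ⟨c, fun x J hJ => ?_⟩
  by_contra! hzero
  rcases hc J (Finset.subset_univ J) with h | h
  · apply hf0
    ext y
    let l : (ι → k) →ₗ[k] k := ∑ i, u i x • LinearMap.proj i
    have hl : ∀ z, l (fun i => v i z⁻¹) = f (x * z⁻¹) := fun z => by simp [l, huv]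
    have hle : Submodule.span k ((fun j i => v i (c j)⁻¹) '' (J : Set (Fin r))) ≤
        LinearMap.ker l := by
      rw [Submodule.span_le]
      rintro _ ⟨j, hj, rfl⟩
      exact (hl (c j)).trans (hzero j hj)
    have := hle (h (y⁻¹ * x))
    rw [LinearMap.mem_ker, hl] at this
    simpa using this
  · have := h.trans (Submodule.finrank_le _)
    rw [Module.finrank_fintype_fun_eq_card] at this
    omega

end GeneralPosition

theorem regularFunctions_separates {k : Type} [Field k] {n : ℕ} {G : Subgroup (GL (Fin n) k)}
    (x y : G) (h : ∀ f ∈ regularFunctions G, f x = f y) : x = y :=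
  Subtype.ext (coords_injective (funext fun i => h _ (coordFun_mem i)))

/-- For a connected affine algebraic group `G` over an algebraically closed field,
an isogeny `F : G → G` and a point `x₀ ∈ G`, the twisted Lang map
`g ↦ g · x₀ · F(g)⁻¹` is surjective iff the twisted stabilizer
`G^{x₀,F} = {g ∈ G | g·x₀·F(g)⁻¹ = x₀}` is finite. -/
theorem twisted_lang_surjective_iff_twisted_stabilizer_finite
    {k : Type} [Field k] [IsAlgClosed k] {n : ℕ}
    (G : Subgroup (GL (Fin n) k))
    (hGcl : IsZClosed (G : Set (GL (Fin n) k)))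
    (hGconn : IsZConnected (G : Set (GL (Fin n) k)))
    (F : GL (Fin n) k → GL (Fin n) k) (hF : IsIsogeny G G F)
    (x₀ : GL (Fin n) k) (hx₀ : x₀ ∈ G) :
    (∀ h ∈ G, ∃ g ∈ G, g * x₀ * (F g)⁻¹ = h) ↔
      {g : GL (Fin n) k | g ∈ G ∧ g * x₀ * (F g)⁻¹ = x₀}.Finite := by
  have hA := isAffineGroupAlgebra_regularFunctions hGcl
  have := isDomain_regularFunctions hGcl hGconn
  have hFG : ∀ g : G, F g ∈ G := fun g => hF.maps g g.2
  let φ : G →* G := MonoidHom.mk' (fun g => ⟨F g, hFG g⟩)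
    fun g h => Subtype.ext (hF.hom g g.2 h h.2)
  let z : G := ⟨x₀, hx₀⟩
  let L : G → G := fun g => g * z * (φ g)⁻¹
  have hφ : ∀ f ∈ regularFunctions G, f ∘ φ ∈ regularFunctions G := by
    intro f hf
    refine comp_mem_regularFunctions (fun i => ?_) hf
    obtain ⟨P, hP⟩ := hF.regular
    exact (mem_regularFunctions G).2 ⟨P i, fun g => congrFun (hP g g.2) i⟩
  have hL : ∀ f ∈ regularFunctions G, f ∘ L ∈ regularFunctions G := by
    intro f hf
    obtain ⟨ι, _, u, v, hu, hv, huv⟩ := hA.comul f hf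
    have : f ∘ L = ∑ i, (fun g => u i (g * z)) * ((fun g => v i g⁻¹) ∘ φ) := by
      ext g
      simp [L, huv]
    rw [this]
    exact sum_mem fun i _ => mul_mem (hA.mul_right (hu i) z) (hφ _ (hA.antipode _ (hv i)))
  have hfibre : ∀ g h, L h = L g ↔ L (g⁻¹ * h) = z := by
    intro g h
    simp only [L, _root_.map_mul, _root_.map_inv]
    constructor <;> intro h'
    · calc g⁻¹ * h * z * ((φ g)⁻¹ * φ h)⁻¹ = g⁻¹ * (h * z * (φ h)⁻¹) * φ g := by group
        _ = z := by rw [h']; group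
    · calc h * z * (φ h)⁻¹ = g * (g⁻¹ * h * z * ((φ g)⁻¹ * φ h)⁻¹) * (φ g)⁻¹ := by group
        _ = g * z * (φ g)⁻¹ := by rw [h']
  have hstab : {g : GL (Fin n) k | g ∈ G ∧ g * x₀ * (F g)⁻¹ = x₀} =
      Subtype.val '' {s : G | L s = z} := by
    ext g
    constructor
    · rintro ⟨hg, h⟩
      exact ⟨⟨g, hg⟩, Subtype.ext h, rfl⟩
    · rintro ⟨s, hs, rfl⟩
      exact ⟨s.2, congrArg Subtype.val hs⟩
  constructor
  · intro hsurj
    have hLsurj : Function.Surjective L := by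
      rintro ⟨h, hh⟩
      obtain ⟨g, hg, hgh⟩ := hsurj h hh
      exact ⟨⟨g, hg⟩, Subtype.ext hgh⟩
    have : Algebra.FiniteType k (regularFunctions G) := ⟨(Subalgebra.fg_top _).2 hA.fg⟩
    obtain ⟨g, hg⟩ := exists_finite_fibre hA.fg regularFunctions_separates hL
      ((comorphism hL).isAlgebraic_range_of_injective
        (comorphism_injective_of_surjective hL hLsurj))
    rw [hstab]
    refine ((hg.image fun h => g⁻¹ * h).subset fun s hs => ⟨g * s, ?_, by simp⟩).image _
    exact (hfibre g (g * s)).2 (by simpa using hs)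
  · intro hfin
    have hS : {s : G | L s = z}.Finite :=
      Set.Finite.of_finite_image (hstab ▸ hfin) Subtype.val_injective.injOn
    have hfib : ∀ g, {h | L h = L g}.Finite := fun g =>
      (hS.image fun s => g * s).subset fun h hh => ⟨g⁻¹ * h, (hfibre g h).1 hh, by simp⟩
    obtain ⟨f, hf, hf0, hfL⟩ :=
      exists_ne_zero_forall_mem_range hA regularFunctions_separates hL hfib
    obtain ⟨d, hd⟩ := hA.exists_translates_cover hf hf0
    obtain ⟨c, hc⟩ := hd (d * {g : GL (Fin n) k | g ∈ G ∧ g * x₀ * (F g)⁻¹ = x₀}.ncard + 1)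
    refine twistedLang_surjective_of_cover G hGcl F hF.maps hF.hom hF.regular hx₀ hfin le_rfl
      (Nat.lt_succ_self _) (fun j => c j) (fun j => (c j).2) fun x hx J hJ => ?_
    obtain ⟨j, hj, hne⟩ := hc ⟨x, hx⟩ J hJ
    obtain ⟨g, hg⟩ := hfL _ hne
    exact ⟨j, hj, g, g.2, congrArg Subtype.val hg⟩

end
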